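/- Let F be self-concordant on an open convex set D ⊆ E and F* self-concordant on an open convex set D* ⊆ E, both with positive definite Hessians on their domains. Let t > 0, β ∈ (0,1), x̄, x̂ ∈ D and s̄, ŝ ∈ D*, and suppose: ∇²F(x̄) = t²·[∇²F*(s̄)]⁻¹; the identity ∇F(x̄) + ∇²F(x̄)(x̂ − x̄) = W( ∇F*(s̄) + ∇²F*(s̄)(ŝ − s̄) ) holds, where W := (1/t)∇²F(x̄); and ‖x̂ − x̄‖_{x̄} ≤ β, ‖ŝ − s̄‖_{s̄} ≤ β (local norms with respect to ∇²F(x̄) and ∇²F*(s̄) respectively). Then ⟨W δ, δ⟩^{1/2} ≤ (2β²/(1 − β))·√t, where δ := ∇F*(ŝ) − W⁻¹∇F(x̂). -/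

import Mathlib

open scoped RealInnerProductSpace

/-- The Hessian of `f` at `x`, as a linear operator on `E` (with respect to the inner product):
the Fréchet derivative of the gradient. -/
noncomputable def hessOp {E : Type*} [NormedAddCommGroup E] [InnerProductSpace ℝ E]
    [CompleteSpace E] (f : E → ℝ) (x : E) : E →L[ℝ] E :=
  fderiv ℝ (gradient f) x

/-- `f` is self-concordant on the open convex set `D`. -/
def SelfConcordantOn {E : Type*} [NormedAddCommGroup E] [InnerProductSpace ℝ E]
    (f : E → ℝ) (D : Set E) : Prop :=
  IsOpen D ∧ Convex ℝ D ∧ ContDiffOn ℝ 3 f D ∧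
    ∀ x ∈ D, ∀ h : E,
      iteratedFDeriv ℝ 3 f x (fun _ => h) ≤
        2 * (iteratedFDeriv ℝ 2 f x (fun _ => h)) ^ ((3 : ℝ) / 2)

/-- The polar form of a binary cubic form is bounded by the sup of the form on the unit circle. -/
lemma cubic_polar_le_of_sq_add_sq_eq_one {A B C D M : ℝ}
    (h : ∀ c s : ℝ, c ^ 2 + s ^ 2 = 1 →
      A * c ^ 3 + 3 * B * (c ^ 2 * s) + 3 * C * (c * s ^ 2) + D * s ^ 3 ≤ M)
    {a b : ℝ} (hab : a ^ 2 + b ^ 2 = 1) : a * A + b * B ≤ M := by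
  obtain ⟨c, s, hcs, rfl, rfl⟩ : ∃ c s : ℝ, c ^ 2 + s ^ 2 = 1 ∧ a = 4 * c ^ 3 - 3 * c ∧
      b = 3 * s - 4 * s ^ 3 := by
    have hz : ‖(⟨a, b⟩ : ℂ)‖ = 1 := by
      rw [Complex.norm_def, Complex.normSq_mk, ← sq, ← sq, hab, Real.sqrt_one]
    have hz0 : (⟨a, b⟩ : ℂ) ≠ 0 := by
      intro h0
      simp [h0] at hz
    refine ⟨Real.cos (Complex.arg ⟨a, b⟩ / 3), Real.sin (Complex.arg ⟨a, b⟩ / 3),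
      Real.cos_sq_add_sin_sq _, ?_, ?_⟩
    · rw [← Real.cos_three_mul, mul_div_cancel₀ _ (three_ne_zero), Complex.cos_arg hz0, hz, div_one]
    · rw [← Real.sin_three_mul, mul_div_cancel₀ _ (three_ne_zero), Complex.sin_arg, hz, div_one]
  obtain ⟨q, hq⟩ : ∃ q : ℝ, q ^ 2 = 3 := ⟨√3, Real.sq_sqrt (by norm_num)⟩
  have key : ∀ c s : ℝ, c ^ 2 + s ^ 2 = 1 → 0 ≤ (3 * c ^ 2 - s ^ 2) ^ 2 / 9 *
      (M - (A * c ^ 3 + 3 * B * (c ^ 2 * s) + 3 * C * (c * s ^ 2) + D * s ^ 3)) :=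
    fun c s hcs => mul_nonneg (by positivity) (sub_nonneg.2 (h c s hcs))
  have h1 := key c s hcs
  have h2 := key (-c / 2 - q / 2 * s) (-s / 2 + q / 2 * c)
    (by linear_combination hcs + (c ^ 2 + s ^ 2) / 4 * (hq))
  have h3 := key (-c / 2 + q / 2 * s) (-s / 2 - q / 2 * c)
    (by linear_combination hcs + (c ^ 2 + s ^ 2) / 4 * (hq))
  have hq4 : q ^ 4 = 9 := by linear_combination (q ^ 2 + 3) * hq
  have hq6 : q ^ 6 = 27 := by linear_combination (q ^ 4 + 3 * q ^ 2 + 9) * hq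
  have hsum := add_nonneg (add_nonneg h1 h2) h3
  have hid : (c ^ 2 + s ^ 2) ^ 2 * (M - ((c ^ 3 - 3 * c * s ^ 2) * A +
      (3 * c ^ 2 * s - s ^ 3) * B)) = M - ((4 * c ^ 3 - 3 * c) * A + (3 * s - 4 * s ^ 3) * B) := by
    rw [hcs]
    linear_combination (3 * c * A - 3 * s * B) * hcs
  rw [← sub_nonneg, ← hid]
  refine hsum.trans_eq ?_
  ring_nf
  simp only [hq, hq4, hq6]
  ring

lemma cubic_polar_le {A B C D M : ℝ}
    (h : ∀ c s : ℝ, c ^ 2 + s ^ 2 = 1 →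
      A * c ^ 3 + 3 * B * (c ^ 2 * s) + 3 * C * (c * s ^ 2) + D * s ^ 3 ≤ M)
    (a b : ℝ) : a * A + b * B ≤ M * √(a ^ 2 + b ^ 2) := by
  rcases eq_or_ne (a ^ 2 + b ^ 2) 0 with h0 | h0
  · have ha : a = 0 := by nlinarith [sq_nonneg a, sq_nonneg b]
    have hb : b = 0 := by nlinarith [sq_nonneg a, sq_nonneg b]
    simp [ha, hb]
  have hpos : 0 < a ^ 2 + b ^ 2 := lt_of_le_of_ne (by positivity) h0.symm
  set ρ := √(a ^ 2 + b ^ 2) with hρ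
  have hρ0 : 0 < ρ := Real.sqrt_pos.2 hpos
  have hρ2 : ρ ^ 2 = a ^ 2 + b ^ 2 := Real.sq_sqrt hpos.le
  have := cubic_polar_le_of_sq_add_sq_eq_one h (a := a / ρ) (b := b / ρ)
    (by rw [div_pow, div_pow, ← add_div, ← hρ2, div_self (by positivity)])
  rw [div_mul_eq_mul_div, div_mul_eq_mul_div, ← add_div, div_le_iff₀ hρ0] at this
  exact this

/-- A symmetric trilinear form whose cubic form is bounded by that of a scalar product satisfies
the corresponding Cauchy–Schwarz type inequality. -/
lemma trilinear_le_of_cubic_le {E : Type*} [NormedAddCommGroup E] [NormedSpace ℝ E]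
    {T : E →L[ℝ] E →L[ℝ] E →L[ℝ] ℝ} {B : E →L[ℝ] E →L[ℝ] ℝ}
    (hT₁ : ∀ u v w, T u v w = T v u w) (hT₂ : ∀ u v w, T u v w = T u w v)
    (hB : ∀ u v, B u v = B v u) (hpos : ∀ u, u ≠ 0 → 0 < B u u)
    (h : ∀ u, T u u u ≤ 2 * (B u u) ^ ((3 : ℝ) / 2)) (u v : E) :
    T u v v ≤ 2 * √(B u u) * B v v := by
  rcases eq_or_ne v 0 with rfl | hv
  · simp
  have hnn : ∀ u, 0 ≤ B u u := fun u => by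
    rcases eq_or_ne u 0 with rfl | hu
    · simp
    · exact (hpos u hu).le
  set n := √(B v v) with hn
  have hn0 : 0 < n := Real.sqrt_pos.2 (hpos v hv)
  have hn2 : n ^ 2 = B v v := Real.sq_sqrt (hnn v)
  obtain ⟨e, hve⟩ : ∃ e, v = n • e := ⟨n⁻¹ • v, by rw [smul_inv_smul₀ hn0.ne']⟩
  have he : B e e = 1 := by
    rw [hve] at hn2
    simp only [map_smul, smul_apply, smul_eq_mul] at hn2
    have : n ^ 2 * (B e e - 1) = 0 := by linear_combination -hn2
    rcases mul_eq_zero.1 this with h0 | h0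
    · exact absurd h0 (by positivity)
    · linarith
  obtain ⟨w, b, hw, hwe, hu⟩ : ∃ (w : E) (b : ℝ), B w w ≤ 1 ∧ B e w = 0 ∧
      u = B e u • e + b • w ∧ B u u = B e u ^ 2 + b ^ 2 := by
    set z := u - B e u • e with hz
    have hez : B e z = 0 := by simp [hz, he]
    have hzz : B u u = B e u ^ 2 + B z z := by
      simp only [hz, map_sub, map_smul, sub_apply,
        smul_apply, smul_eq_mul, he, hB u e]
      ring
    rcases eq_or_ne z 0 with h0 | h0
    · refine ⟨0, 0, by simp, by simp, ?_, ?_⟩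
      · simpa using sub_eq_zero.1 h0
      · simpa [h0] using hzz
    · have hm0 : 0 < √(B z z) := Real.sqrt_pos.2 (hpos z h0)
      have hm2 : √(B z z) ^ 2 = B z z := Real.sq_sqrt (hnn z)
      refine ⟨(√(B z z))⁻¹ • z, √(B z z), ?_, ?_, ?_, ?_⟩
      · simp only [map_smul, smul_apply, smul_eq_mul]
        rw [← hm2, Real.sqrt_sq hm0.le]
        field_simp
        exact le_rfl
      · simp [hez]
      · rw [smul_inv_smul₀ hm0.ne', hz]
        abel
      · rw [hm2, hzz]
  obtain ⟨hu, huu⟩ := hu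
  have key := cubic_polar_le (A := T e e e) (B := T e e w) (C := T e w w) (D := T w w w) (M := 2)
    (fun c s hcs => by
      have h1 := h (c • e + s • w)
      have h2 : B (c • e + s • w) (c • e + s • w) ≤ 1 := by
        simp only [map_add, map_smul, add_apply,
          smul_apply, smul_eq_mul, he, hwe, hB w e]
        nlinarith [mul_le_mul_of_nonneg_left hw (sq_nonneg s)]
      have h3 := Real.rpow_le_one (hnn (c • e + s • w)) h2 (by norm_num : (0 : ℝ) ≤ 3 / 2)
      refine le_trans (le_of_eq ?_) (h1.trans (by linarith))
      simp only [map_add, map_smul, add_apply,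
          smul_apply, smul_eq_mul, hT₂ e w e, hT₁ w e e, hT₁ w e w, hT₂ w w e]
      ring) (B e u) b
  rw [← huu] at key
  have hT : T u e e = B e u * T e e e + b * T e e w := by
    conv_lhs => rw [hu]
    simp [hT₁ w e e, hT₂ e w e]
  rw [← hT] at key
  rw [← hn2, hve]
  simp only [map_smul, smul_apply, smul_eq_mul]
  nlinarith [mul_le_mul_of_nonneg_left key (sq_nonneg n)]

lemma monotoneOn_Icc_of_hasDerivAt_nonneg {f f' : ℝ → ℝ} {a b : ℝ}
    (hf : ∀ τ ∈ Set.Icc a b, HasDerivAt f (f' τ) τ) (hf' : ∀ τ ∈ Set.Icc a b, 0 ≤ f' τ) :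
    MonotoneOn f (Set.Icc a b) :=
  monotoneOn_of_hasDerivWithinAt_nonneg (convex_Icc a b)
    (fun τ hτ => (hf τ hτ).continuousAt.continuousWithinAt)
    (fun τ hτ => (hf τ (interior_subset hτ)).hasDerivWithinAt)
    (fun τ hτ => hf' τ (interior_subset hτ))

lemma sqrt_mul_one_sub_le_of_deriv_le {φ φ' : ℝ → ℝ}
    (hφ : ∀ τ ∈ Set.Icc (0 : ℝ) 1, HasDerivAt φ (φ' τ) τ)
    (hpos : ∀ τ ∈ Set.Icc (0 : ℝ) 1, 0 < φ τ)
    (hle : ∀ τ ∈ Set.Icc (0 : ℝ) 1, φ' τ ≤ 2 * √(φ τ) * φ τ) {τ : ℝ}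
    (hτ : τ ∈ Set.Icc (0 : ℝ) 1) : √(φ τ) * (1 - τ * √(φ 0)) ≤ √(φ 0) := by
  have hd : ∀ τ ∈ Set.Icc (0 : ℝ) 1, HasDerivAt (fun τ => (√(φ τ))⁻¹ + τ)
      (-(φ' τ / (2 * √(φ τ))) / √(φ τ) ^ 2 + 1) τ := fun τ hτ =>
    (((hφ τ hτ).sqrt (hpos τ hτ).ne').inv (Real.sqrt_pos.2 (hpos τ hτ)).ne').add (hasDerivAt_id τ)
  have hmono := monotoneOn_Icc_of_hasDerivAt_nonneg hd (fun τ hτ => by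
    have h1 := Real.sqrt_pos.2 (hpos τ hτ)
    have h2 : φ' τ / (2 * √(φ τ)) ≤ √(φ τ) ^ 2 := by
      rw [div_le_iff₀ (by positivity), Real.sq_sqrt (hpos τ hτ).le]
      linarith [hle τ hτ]
    have h3 : φ' τ / (2 * √(φ τ)) / √(φ τ) ^ 2 ≤ 1 := (div_le_one (by positivity)).2 h2
    rw [neg_div]
    linarith)
  have h0 : (0 : ℝ) ∈ Set.Icc (0 : ℝ) 1 := by simp
  have h := hmono h0 hτ hτ.1
  have hp0 := Real.sqrt_pos.2 (hpos 0 h0)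
  have hpτ := Real.sqrt_pos.2 (hpos τ hτ)
  simp only [add_zero] at h
  have := mul_le_mul_of_nonneg_left h (mul_pos hp0 hpτ).le
  field_simp at this
  linarith

lemma abs_sub_le_of_abs_deriv_le {ψ ψ' : ℝ → ℝ} {r : ℝ} (hr0 : 0 ≤ r) (hr : r < 1)
    (hψ : ∀ τ ∈ Set.Icc (0 : ℝ) 1, HasDerivAt ψ (ψ' τ) τ)
    (hle : ∀ τ ∈ Set.Icc (0 : ℝ) 1, (1 - τ * r) * |ψ' τ| ≤ 2 * r * ψ τ) (hnn : 0 ≤ ψ 0) {τ : ℝ}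
    (hτ : τ ∈ Set.Icc (0 : ℝ) 1) : |ψ τ - ψ 0| ≤ (((1 - τ * r) ^ 2)⁻¹ - 1) * ψ 0 := by
  have hpos : ∀ τ ∈ Set.Icc (0 : ℝ) 1, 0 < 1 - τ * r := fun τ hτ => by
    nlinarith [hτ.1, hτ.2]
  have hlin : ∀ τ : ℝ, HasDerivAt (fun τ : ℝ => (1 - τ * r) ^ 2) (2 * (1 - τ * r) * (-r)) τ :=
    fun τ => ((((hasDerivAt_id τ).mul_const r).const_sub 1).pow 2).congr_deriv (by simp)
  have hmono₁ := monotoneOn_Icc_of_hasDerivAt_nonneg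
    (fun τ hτ => ((hψ τ hτ).mul (hlin τ)).neg) (fun τ hτ => by
      have h1 := hle τ hτ
      have h2 := mul_le_mul_of_nonneg_left (le_abs_self (ψ' τ)) (hpos τ hτ).le
      nlinarith [hpos τ hτ])
  have hmono₂ := monotoneOn_Icc_of_hasDerivAt_nonneg
    (fun τ hτ => (hψ τ hτ).div (hlin τ) (pow_pos (hpos τ hτ) 2).ne') (fun τ hτ => by
      have h1 := hle τ hτ
      have h2 := mul_le_mul_of_nonneg_left (neg_abs_le (ψ' τ)) (hpos τ hτ).le
      refine div_nonneg ?_ (by positivity)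
      nlinarith [hpos τ hτ])
  have h0 : (0 : ℝ) ∈ Set.Icc (0 : ℝ) 1 := by simp
  have h1 := hmono₁ h0 hτ hτ.1
  have h2 := hmono₂ h0 hτ hτ.1
  simp only [Pi.neg_apply, Pi.mul_apply, Pi.div_apply, zero_mul, sub_zero, one_pow, mul_one,
    div_one, neg_le_neg_iff] at h1 h2
  have hp := hpos τ hτ
  have hq : 0 < (1 - τ * r) ^ 2 := by positivity
  have hq1 : (1 - τ * r) ^ 2 ≤ 1 := pow_le_one₀ hp.le (by nlinarith [hτ.1])
  have hup : ψ τ ≤ ((1 - τ * r) ^ 2)⁻¹ * ψ 0 := by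
    rw [inv_mul_eq_div, le_div_iff₀ hq]
    exact h1
  rw [le_div_iff₀ hq] at h2
  have hinv : 2 - (1 - τ * r) ^ 2 ≤ ((1 - τ * r) ^ 2)⁻¹ := by
    rw [← one_div, le_div_iff₀ hq]
    nlinarith [sq_nonneg ((1 - τ * r) ^ 2 - 1)]
  rw [abs_le]
  constructor
  · nlinarith [mul_le_mul_of_nonneg_right hinv hnn]
  · linarith

/-- A symmetric bilinear form dominated on the diagonal by a scalar product is dominated off the
diagonal as well. -/
lemma bilin_le_of_abs_diag_le {E : Type*} [NormedAddCommGroup E] [NormedSpace ℝ E]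
    {S B : E →L[ℝ] E →L[ℝ] ℝ} {c : ℝ} (hS : ∀ u v, S u v = S v u) (hB : ∀ u v, B u v = B v u)
    (hpos : ∀ u, u ≠ 0 → 0 < B u u) (h : ∀ u, |S u u| ≤ c * B u u) (u v : E) :
    S u v ≤ c * (√(B u u) * √(B v v)) := by
  rcases eq_or_ne u 0 with rfl | hu
  · simp
  rcases eq_or_ne v 0 with rfl | hv
  · simp
  set p := √(B u u) with hp
  set q := √(B v v) with hq
  have hp0 : 0 < p := Real.sqrt_pos.2 (hpos u hu)
  have hq0 : 0 < q := Real.sqrt_pos.2 (hpos v hv)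
  have hp2 : p ^ 2 = B u u := Real.sq_sqrt (hpos u hu).le
  have hq2 : q ^ 2 = B v v := Real.sq_sqrt (hpos v hv).le
  have h1 := (le_abs_self _).trans (h (q • u + p • v))
  have h2 := (neg_le_abs _).trans (h (q • u - p • v))
  simp only [map_add, map_sub, map_smul, add_apply, sub_apply, smul_apply, smul_eq_mul, hS v u,
    hB v u, ← hp2, ← hq2] at h1 h2
  have h3 : (p * q) * S u v ≤ (p * q) * (c * (p * q)) := by nlinarith
  exact le_of_mul_le_mul_left h3 (mul_pos hp0 hq0)

section SelfConcordant

variable {E : Type*} [NormedAddCommGroup E] [NormedSpace ℝ E]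

lemma hasFDerivAt_fderiv_fderiv_apply {f : E → ℝ} {x : E} (hf : ContDiffAt ℝ 3 f x) (u v : E) :
    HasFDerivAt (fun y => fderiv ℝ (fderiv ℝ f) y u v)
      (((fderiv ℝ (fderiv ℝ (fderiv ℝ f)) x).flip u).flip v) x := by
  have h2 : DifferentiableAt ℝ (fderiv ℝ (fderiv ℝ f)) x :=
    ((hf.fderiv_right (m := 2) (by norm_num)).fderiv_right (m := 1)
      (by norm_num)).differentiableAt (by norm_num)
  refine ((h2.hasFDerivAt.clm_apply (hasFDerivAt_const u x)).clm_apply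
    (hasFDerivAt_const v x)).congr_fderiv ?_
  ext w
  simp

lemma iteratedFDeriv_three_apply_diag {f : E → ℝ} {x : E} (hf : ContDiffAt ℝ 3 f x) (h : E) :
    iteratedFDeriv ℝ 3 f x (fun _ => h) = fderiv ℝ (fderiv ℝ (fderiv ℝ f)) x h h h := by
  rw [(hf.differentiableAt_iteratedFDeriv (m := 2) (by norm_num)).iteratedFDeriv_succ_apply_left']
  simp only [iteratedFDeriv_two_apply, Fin.tail]
  rw [(hasFDerivAt_fderiv_fderiv_apply hf h h).fderiv]
  simp

lemma fderiv_fderiv_fderiv_swap₁ {f : E → ℝ} {x : E} (hf : ContDiffAt ℝ 3 f x) (u v w : E) :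
    fderiv ℝ (fderiv ℝ (fderiv ℝ f)) x u v w = fderiv ℝ (fderiv ℝ (fderiv ℝ f)) x v u w := by
  have := (hf.fderiv_right (m := 2) (by norm_num)).isSymmSndFDerivAt (by simp)
  rw [this u v]

lemma fderiv_fderiv_swap {f : E → ℝ} {x : E} (hf : ContDiffAt ℝ 3 f x) (u v : E) :
    fderiv ℝ (fderiv ℝ f) x u v = fderiv ℝ (fderiv ℝ f) x v u :=
  hf.isSymmSndFDerivAt (by simp; norm_num) u v

lemma fderiv_fderiv_fderiv_swap₂ {f : E → ℝ} {x : E} (hf : ContDiffAt ℝ 3 f x) (u v w : E) :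
    fderiv ℝ (fderiv ℝ (fderiv ℝ f)) x u v w = fderiv ℝ (fderiv ℝ (fderiv ℝ f)) x u w v := by
  have h : (fun y => fderiv ℝ (fderiv ℝ f) y v w) =ᶠ[nhds x]
      fun y => fderiv ℝ (fderiv ℝ f) y w v := by
    filter_upwards [hf.eventually (by simp)] with y hy
    exact fderiv_fderiv_swap hy v w
  exact DFunLike.congr_fun ((hasFDerivAt_fderiv_fderiv_apply hf v w).unique
    ((hasFDerivAt_fderiv_fderiv_apply hf w v).congr_of_eventuallyEq h)) u

lemma hasDerivAt_line (x d : E) (τ : ℝ) : HasDerivAt (fun τ : ℝ => x + τ • d) d τ := by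
  simpa using ((hasDerivAt_id τ).smul_const d).const_add x

lemma hasDerivAt_fderiv_fderiv_line {f : E → ℝ} {x d : E} {τ : ℝ}
    (hf : ContDiffAt ℝ 3 f (x + τ • d)) (u v : E) :
    HasDerivAt (fun τ : ℝ => fderiv ℝ (fderiv ℝ f) (x + τ • d) u v)
      (fderiv ℝ (fderiv ℝ (fderiv ℝ f)) (x + τ • d) d u v) τ := by
  have h := hasFDerivAt_fderiv_fderiv_apply hf u v
  exact h.comp_hasDerivAt τ (hasDerivAt_line x d τ)

lemma hasDerivAt_fderiv_line {f : E → ℝ} {x d : E} {τ : ℝ}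
    (hf : ContDiffAt ℝ 3 f (x + τ • d)) (v : E) :
    HasDerivAt (fun τ : ℝ => fderiv ℝ f (x + τ • d) v)
      (fderiv ℝ (fderiv ℝ f) (x + τ • d) d v) τ := by
  have h2 : DifferentiableAt ℝ (fderiv ℝ f) (x + τ • d) :=
    (hf.fderiv_right (m := 2) (by norm_num)).differentiableAt (by norm_num)
  have h3 : HasFDerivAt (fun y => fderiv ℝ f y v) ((fderiv ℝ (fderiv ℝ f) (x + τ • d)).flip v)
      (x + τ • d) :=
    (h2.hasFDerivAt.clm_apply (hasFDerivAt_const v _)).congr_fderiv (by ext w; simp)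
  exact h3.comp_hasDerivAt τ (hasDerivAt_line x d τ)

end SelfConcordant

section Gradient

variable {E : Type*} [NormedAddCommGroup E] [InnerProductSpace ℝ E]

/-- The local gradient estimate for self-concordant functions, in weak form. -/
lemma SelfConcordantOn.fderiv_sub_le {f : E → ℝ} {D : Set E} (hf : SelfConcordantOn f D)
    (hpos : ∀ x ∈ D, ∀ u : E, u ≠ 0 → 0 < fderiv ℝ (fderiv ℝ f) x u u)
    {x y : E} (hx : x ∈ D) (hy : y ∈ D) {r : ℝ}
    (hr : √(fderiv ℝ (fderiv ℝ f) x (y - x) (y - x)) = r) (hr1 : r < 1) (v : E) :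
    fderiv ℝ f y v - fderiv ℝ f x v - fderiv ℝ (fderiv ℝ f) x (y - x) v ≤
      r ^ 2 / (1 - r) * √(fderiv ℝ (fderiv ℝ f) x v v) := by
  obtain ⟨hopen, hconv, hcd, hsc⟩ := hf
  rcases eq_or_ne (y - x) 0 with hd | hd
  · obtain rfl : y = x := sub_eq_zero.1 hd
    simp at hr
    simp [← hr]
  obtain ⟨d, hdy⟩ : ∃ d, y - x = d := ⟨_, rfl⟩
  rw [hdy] at hd hr ⊢
  obtain rfl : y = x + d := by rw [← hdy]; abel
  have hC : ∀ z ∈ D, ContDiffAt ℝ 3 f z := fun z hz => hcd.contDiffAt (hopen.mem_nhds hz)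
  have hline : ∀ τ ∈ Set.Icc (0 : ℝ) 1, x + τ • d ∈ D := fun τ hτ => by
    simpa using hconv.add_smul_sub_mem hx hy hτ
  have hr0 : 0 ≤ r := hr ▸ Real.sqrt_nonneg _
  have hT : ∀ z ∈ D, ∀ u v, fderiv ℝ (fderiv ℝ (fderiv ℝ f)) z u v v ≤
      2 * √(fderiv ℝ (fderiv ℝ f) z u u) * fderiv ℝ (fderiv ℝ f) z v v := fun z hz =>
    trilinear_le_of_cubic_le (fderiv_fderiv_fderiv_swap₁ (hC z hz))
      (fderiv_fderiv_fderiv_swap₂ (hC z hz)) (fderiv_fderiv_swap (hC z hz)) (hpos z hz)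
      (fun u => by
        have := hsc z hz u
        rwa [iteratedFDeriv_three_apply_diag (hC z hz), iteratedFDeriv_two_apply] at this)
  have hT' : ∀ z ∈ D, ∀ u v, |fderiv ℝ (fderiv ℝ (fderiv ℝ f)) z u v v| ≤
      2 * √(fderiv ℝ (fderiv ℝ f) z u u) * fderiv ℝ (fderiv ℝ f) z v v := fun z hz u v => by
    refine abs_le'.2 ⟨hT z hz u v, ?_⟩
    simpa using hT z hz (-u) v
  have hd_le : ∀ τ ∈ Set.Icc (0 : ℝ) 1,
      √(fderiv ℝ (fderiv ℝ f) (x + τ • d) d d) * (1 - τ * r) ≤ r := fun τ hτ => by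
    have := sqrt_mul_one_sub_le_of_deriv_le
      (fun τ hτ => hasDerivAt_fderiv_fderiv_line (hC _ (hline τ hτ)) d d)
      (fun τ hτ => hpos _ (hline τ hτ) d hd) (fun τ hτ => hT _ (hline τ hτ) d d) hτ
    simpa only [zero_smul, add_zero, hr] using this
  have hnn : ∀ z ∈ D, ∀ u, 0 ≤ fderiv ℝ (fderiv ℝ f) z u u := fun z hz u => by
    rcases eq_or_ne u 0 with rfl | hu
    · simp
    · exact (hpos z hz u hu).le
  have hone : ∀ τ ∈ Set.Icc (0 : ℝ) 1, 0 < 1 - τ * r := fun τ hτ => by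
    nlinarith [hτ.1, hτ.2]
  have hdiag : ∀ τ ∈ Set.Icc (0 : ℝ) 1, ∀ u,
      |(fderiv ℝ (fderiv ℝ f) (x + τ • d) - fderiv ℝ (fderiv ℝ f) x) u u| ≤
        (((1 - τ * r) ^ 2)⁻¹ - 1) * fderiv ℝ (fderiv ℝ f) x u u := fun τ hτ u => by
    have := abs_sub_le_of_abs_deriv_le hr0 hr1
      (fun τ hτ => hasDerivAt_fderiv_fderiv_line (hC _ (hline τ hτ)) u u)
      (fun τ hτ => by
        have h1 := mul_le_mul_of_nonneg_left (hT' _ (hline τ hτ) d u) (hone τ hτ).le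
        have h2 := mul_le_mul_of_nonneg_right (hd_le τ hτ) (hnn _ (hline τ hτ) u)
        linarith) (by simpa using hnn x hx u) hτ
    simpa only [zero_smul, add_zero, sub_apply] using this
  set N := √(fderiv ℝ (fderiv ℝ f) x v v) with hN
  have hderiv : ∀ τ ∈ Set.Icc (0 : ℝ) 1, HasDerivAt
      (fun τ : ℝ => N * ((1 - τ * r)⁻¹ - τ * r) -
        (fderiv ℝ f (x + τ • d) v - τ * fderiv ℝ (fderiv ℝ f) x d v))
      (N * (r / (1 - τ * r) ^ 2 - r) -
        (fderiv ℝ (fderiv ℝ f) (x + τ • d) d v - fderiv ℝ (fderiv ℝ f) x d v)) τ :=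
    fun τ hτ => by
      have hl : HasDerivAt (fun τ : ℝ => τ * r) r τ := by
        simpa using (hasDerivAt_id τ).mul_const r
      have hm : HasDerivAt (fun τ : ℝ => τ * fderiv ℝ (fderiv ℝ f) x d v)
          (fderiv ℝ (fderiv ℝ f) x d v) τ := by
        simpa using (hasDerivAt_id τ).mul_const (fderiv ℝ (fderiv ℝ f) x d v)
      exact (((((hl.const_sub 1).inv (hone τ hτ).ne').sub hl).const_mul N).sub
        ((hasDerivAt_fderiv_line (hC _ (hline τ hτ)) v).sub hm)).congr_deriv (by simp)
  have hmono := monotoneOn_Icc_of_hasDerivAt_nonneg hderiv (fun τ hτ => by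
    have h1 := bilin_le_of_abs_diag_le
      (S := fderiv ℝ (fderiv ℝ f) (x + τ • d) - fderiv ℝ (fderiv ℝ f) x)
      (fun u v => by
        rw [sub_apply, sub_apply, sub_apply, sub_apply, fderiv_fderiv_swap (hC _ (hline τ hτ)),
          fderiv_fderiv_swap (hC x hx)])
      (fderiv_fderiv_swap (hC x hx)) (hpos x hx) (hdiag τ hτ) d v
    rw [hr, ← hN, sub_apply, sub_apply] at h1
    rw [div_eq_mul_inv]
    linarith)
  have h := hmono (by simp : (0 : ℝ) ∈ Set.Icc (0 : ℝ) 1) (by simp : (1 : ℝ) ∈ Set.Icc (0 : ℝ) 1)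
    zero_le_one
  simp only [zero_smul, add_zero, one_smul, zero_mul, one_mul, sub_zero, inv_one, mul_one] at h
  have hid : r ^ 2 / (1 - r) = (1 - r)⁻¹ - r - 1 := by
    have : 1 - r ≠ 0 := by linarith
    field_simp
    ring
  rw [hid]
  linarith

variable [CompleteSpace E]

lemma inner_gradient_eq (f : E → ℝ) (x v : E) : ⟪gradient f x, v⟫ = fderiv ℝ f x v := by
  simp [gradient]

lemma inner_hessOp_eq (f : E → ℝ) (x u v : E) :
    ⟪hessOp f x u, v⟫ = fderiv ℝ (fderiv ℝ f) x u v := by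
  have : gradient f = (InnerProductSpace.toDual ℝ E).symm.toContinuousLinearEquiv ∘ fderiv ℝ f :=
    rfl
  rw [hessOp, this, ContinuousLinearEquiv.comp_fderiv]
  simp

/-- The local gradient estimate for self-concordant functions, tested against a vector. -/
lemma SelfConcordantOn.abs_inner_gradient_sub_le {f : E → ℝ} {D : Set E}
    (hf : SelfConcordantOn f D)
    (hpos : ∀ x ∈ D, ∀ u : E, u ≠ 0 → 0 < ⟪hessOp f x u, u⟫) {x y : E} (hx : x ∈ D) (hy : y ∈ D)
    {β : ℝ} (hβ : β < 1) (hr : √⟪hessOp f x (y - x), y - x⟫ ≤ β) (v : E) :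
    |⟪gradient f y - gradient f x - hessOp f x (y - x), v⟫| ≤
      β ^ 2 / (1 - β) * √⟪hessOp f x v, v⟫ := by
  simp only [inner_hessOp_eq] at hpos hr
  simp only [inner_sub_left, inner_gradient_eq, inner_hessOp_eq]
  have key := hf.fderiv_sub_le hpos hx hy rfl (hr.trans_lt hβ)
  have hmono : ∀ r : ℝ, 0 ≤ r → r ≤ β → r ^ 2 / (1 - r) ≤ β ^ 2 / (1 - β) := fun r h0 h1 => by
    have : 0 < 1 - β := by linarith
    gcongr
  have hle := mul_le_mul_of_nonneg_right (hmono _ (Real.sqrt_nonneg _) hr)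
    (Real.sqrt_nonneg (fderiv ℝ (fderiv ℝ f) x v v))
  refine abs_le'.2 ⟨(key v).trans hle, le_trans (le_of_eq ?_) (((key (-v)).trans_eq ?_).trans hle)⟩
  · simp only [map_neg]
    ring
  · simp

end Gradient

/-- inequality (5.5) of Lemma 5.1 of the paper. Let `F`, `F*` be
self-concordant on `D`, `D*` with positive definite Hessians, `t > 0`, `β ∈ (0,1)`.
Assume `∇²F(x̄) = t² [∇²F*(s̄)]⁻¹` (formalized as `∇²F(x̄) ∘ ∇²F*(s̄) = t² id`, so that
`W⁻¹ = (1/t) ∇²F*(s̄)` where `W = (1/t) ∇²F(x̄)`), the identity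
`∇F(x̄) + ∇²F(x̄)(x̂ - x̄) = W(∇F*(s̄) + ∇²F*(s̄)(ŝ - s̄))`, and `‖x̂ - x̄‖_{x̄} ≤ β`,
`‖ŝ - s̄‖_{s̄} ≤ β`. Then for `δ = ∇F*(ŝ) - W⁻¹ ∇F(x̂)` one has
`⟨W δ, δ⟩^{1/2} ≤ (2β²/(1-β)) √t`. -/
theorem stmt8 {E : Type*} [NormedAddCommGroup E] [InnerProductSpace ℝ E]
    [FiniteDimensional ℝ E]
    (F Fstar : E → ℝ) (D Dstar : Set E)
    (hF : SelfConcordantOn F D) (hFs : SelfConcordantOn Fstar Dstar)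
    (hFpos : ∀ x ∈ D, ∀ u : E, u ≠ 0 → 0 < ⟪hessOp F x u, u⟫)
    (hFspos : ∀ s ∈ Dstar, ∀ u : E, u ≠ 0 → 0 < ⟪hessOp Fstar s u, u⟫)
    (t β : ℝ) (ht : 0 < t) (hβ : β ∈ Set.Ioo (0 : ℝ) 1)
    (xb xh : E) (hxb : xb ∈ D) (hxh : xh ∈ D)
    (sb sh : E) (hsb : sb ∈ Dstar) (hsh : sh ∈ Dstar)
    (hHrel : ∀ u : E, hessOp F xb (hessOp Fstar sb u) = t ^ 2 • u)
    (hident : gradient F xb + hessOp F xb (xh - xb)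
      = (1 / t) • hessOp F xb (gradient Fstar sb + hessOp Fstar sb (sh - sb)))
    (hclose1 : Real.sqrt ⟪hessOp F xb (xh - xb), xh - xb⟫ ≤ β)
    (hclose2 : Real.sqrt ⟪hessOp Fstar sb (sh - sb), sh - sb⟫ ≤ β) :
    Real.sqrt ⟪(1 / t) • hessOp F xb
        (gradient Fstar sh - (1 / t) • hessOp Fstar sb (gradient F xh)),
        gradient Fstar sh - (1 / t) • hessOp Fstar sb (gradient F xh)⟫
      ≤ (2 * β ^ 2 / (1 - β)) * Real.sqrt t := by
  obtain ⟨hβ0, hβ1⟩ := hβ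
  set δ := gradient Fstar sh - (1 / t) • hessOp Fstar sb (gradient F xh) with hδ
  set w := (1 / t) • hessOp F xb δ with hw
  set κ := β ^ 2 / (1 - β) with hκ
  have hsymm : ∀ u v, ⟪hessOp F xb u, v⟫ = ⟪u, hessOp F xb v⟫ := fun u v => by
    rw [real_inner_comm, real_inner_comm, inner_hessOp_eq, real_inner_comm, inner_hessOp_eq,
      fderiv_fderiv_swap (hF.2.2.1.contDiffAt (hF.1.mem_nhds hxb))]
  have hdecomp : ⟪w, δ⟫ = ⟪gradient Fstar sh - gradient Fstar sb - hessOp Fstar sb (sh - sb), w⟫ -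
      ⟪gradient F xh - gradient F xb - hessOp F xb (xh - xb), δ⟫ := by
    have hswap : ∀ u, ⟪u, w⟫ = ⟪(1 / t) • hessOp F xb u, δ⟫ := fun u => by
      rw [hw, inner_smul_right, inner_smul_left, hsymm]
      rfl
    have hw' : w = (1 / t) • hessOp F xb (gradient Fstar sh) - gradient F xh := by
      rw [hw, hδ, map_sub, map_smul, hHrel, smul_sub, smul_smul, smul_smul,
        show 1 / t * (1 / t) * t ^ 2 = 1 by field_simp, one_smul]
    rw [hswap, ← inner_sub_left]
    congr 1
    rw [hw', sub_sub, sub_sub, map_sub, smul_sub, ← hident]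
    abel
  have h1 := (le_abs_self _).trans (hFs.abs_inner_gradient_sub_le hFspos hsb hsh hβ1 hclose2 w)
  have h2 := (neg_le_abs _).trans (hF.abs_inner_gradient_sub_le hFpos hxb hxh hβ1 hclose1 δ)
  have hn1 : ⟪hessOp F xb δ, δ⟫ = t * ⟪w, δ⟫ := by
    rw [hw, real_inner_smul_left]
    field_simp
  have hn2 : ⟪hessOp Fstar sb w, w⟫ = t * ⟪w, δ⟫ := by
    rw [← hn1]
    nth_rewrite 2 [hw]
    rw [inner_smul_right, ← hsymm, hHrel, hw, real_inner_smul_left, real_inner_smul_left]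
    field_simp
  rw [hn2, Real.sqrt_mul ht.le] at h1
  rw [hn1, Real.sqrt_mul ht.le] at h2
  rcases (Real.sqrt_nonneg ⟪w, δ⟫).eq_or_lt with h0 | h0
  · rw [← h0]
    have : 0 < 1 - β := by linarith
    positivity
  have hsq : √⟪w, δ⟫ ^ 2 = ⟪w, δ⟫ := Real.sq_sqrt (Real.sqrt_pos.1 h0).le
  have hfin : √⟪w, δ⟫ * √⟪w, δ⟫ ≤ (2 * κ * √t) * √⟪w, δ⟫ := by
    rw [← sq, hsq]
    linarith
  have := le_of_mul_le_mul_right hfin h0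
  rwa [hκ, ← mul_div_assoc] at this
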